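/- Let ψ ∈ ℂ^{2^n} be a unit vector and A ⊆ [n]. Suppose stab(ψ) is Type I at A or Type II at A. Then ⟨ψ, ((I − H_A)/2) ψ⟩ ≥ sin²(π/8). -/

import Mathlib

open Matrix

noncomputable section

/-- The space of `n`-qubit operators (2^n × 2^n complex matrices, indexed by bit strings). -/
abbrev QMat (n : ℕ) := Matrix (Fin n → Fin 2) (Fin n → Fin 2) ℂ

/-- The space of `n`-qubit state vectors (ℂ^{2^n}, indexed by bit strings). -/
abbrev QVec (n : ℕ) := (Fin n → Fin 2) → ℂ

def PauliX : Matrix (Fin 2) (Fin 2) ℂ := !![0, 1; 1, 0]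
def PauliY : Matrix (Fin 2) (Fin 2) ℂ := !![0, -Complex.I; Complex.I, 0]
def PauliZ : Matrix (Fin 2) (Fin 2) ℂ := !![1, 0; 0, -1]

/-- `Q` is one of the four single-qubit Pauli matrices `I, X, Y, Z`. -/
def IsSingleQubitPauli (Q : Matrix (Fin 2) (Fin 2) ℂ) : Prop :=
  Q = 1 ∨ Q = PauliX ∨ Q = PauliY ∨ Q = PauliZ

/-- Kronecker product, in qubit order, of `n` single-qubit operators. -/
def tensorn (n : ℕ) (Q : Fin n → Matrix (Fin 2) (Fin 2) ℂ) : QMat n :=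
  fun x y => ∏ j, Q j (x j) (y j)

/-- `P` is an element of the `n`-qubit Pauli group: `P = i^ℓ · Q_1 ⊗ ⋯ ⊗ Q_n`. -/
def IsPauli {n : ℕ} (P : QMat n) : Prop :=
  ∃ (ℓ : Fin 4) (Q : Fin n → Matrix (Fin 2) (Fin 2) ℂ),
    (∀ j, IsSingleQubitPauli (Q j)) ∧ P = (Complex.I ^ (ℓ : ℕ)) • tensorn n Q

/-- The Hadamard matrix `H = (1/√2)[[1,1],[1,-1]]`. -/
def Had2 : Matrix (Fin 2) (Fin 2) ℂ := ((Real.sqrt 2 : ℂ))⁻¹ • !![1, 1; 1, -1]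

/-- `H_A`: Hadamard on every qubit in `A`, identity elsewhere. -/
def HadOn {n : ℕ} (A : Finset (Fin n)) : QMat n :=
  tensorn n (fun j => if j ∈ A then Had2 else 1)

/-- `stab(ψ)` is of Type I at `A`: some `P = i^ℓ·Q_1⊗⋯⊗Q_n ∈ stab(ψ)` has
`Q_j ∈ {I, Y}` for every `j ∈ A`, with an odd number of `Y`'s in `A`. -/
def TypeIAt {n : ℕ} (ψ : QVec n) (A : Finset (Fin n)) : Prop :=
  ∃ (ℓ : Fin 4) (Q : Fin n → Matrix (Fin 2) (Fin 2) ℂ),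
    (∀ j, IsSingleQubitPauli (Q j)) ∧
    ((Complex.I ^ (ℓ : ℕ)) • tensorn n Q) *ᵥ ψ = ψ ∧
    (∀ j ∈ A, Q j = 1 ∨ Q j = PauliY) ∧
    Odd (Set.ncard {j : Fin n | j ∈ A ∧ Q j = PauliY})

/-- `stab(ψ)` is of Type II at `A`: some `P = i^ℓ·Q_1⊗⋯⊗Q_n ∈ stab(ψ)` has an odd
total number of `X`'s and `Z`'s in `A`. -/
def TypeIIAt {n : ℕ} (ψ : QVec n) (A : Finset (Fin n)) : Prop :=
  ∃ (ℓ : Fin 4) (Q : Fin n → Matrix (Fin 2) (Fin 2) ℂ),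
    (∀ j, IsSingleQubitPauli (Q j)) ∧
    ((Complex.I ^ (ℓ : ℕ)) • tensorn n Q) *ᵥ ψ = ψ ∧
    Odd (Set.ncard {j : Fin n | j ∈ A ∧ (Q j = PauliX ∨ Q j = PauliZ)})

theorem tensorn_mul {n : ℕ} (Q R : Fin n → Matrix (Fin 2) (Fin 2) ℂ) :
    tensorn n Q * tensorn n R = tensorn n (fun j => Q j * R j) := by
  ext x y
  simp only [tensorn, Matrix.mul_apply, ← Finset.prod_mul_distrib, Finset.prod_univ_sum,
    Fintype.piFinset_univ]

theorem tensorn_one (n : ℕ) : tensorn n (fun _ => 1) = 1 := by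
  ext x y
  simp only [tensorn, Matrix.one_apply, funext_iff]
  convert Fintype.prod_boole (M₀ := ℂ) (p := fun j => x j = y j)

theorem tensorn_conjTranspose {n : ℕ} (Q : Fin n → Matrix (Fin 2) (Fin 2) ℂ) :
    (tensorn n Q)ᴴ = tensorn n (fun j => (Q j)ᴴ) := by
  ext x y
  simp [tensorn, Matrix.conjTranspose_apply]

theorem tensorn_smul {n : ℕ} (s : Fin n → ℂ) (Q : Fin n → Matrix (Fin 2) (Fin 2) ℂ) :
    tensorn n (fun j => s j • Q j) = (∏ j, s j) • tensorn n Q := by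
  ext x y
  simp [tensorn, Finset.prod_mul_distrib]

/-- Tensor products whose factors commute, except for an odd number of places where they
anticommute, anticommute. -/
theorem tensorn_anticomm {n : ℕ} (Q R : Fin n → Matrix (Fin 2) (Fin 2) ℂ) (p : Fin n → Prop)
    (hp : Odd (Set.ncard {j | p j}))
    (hanti : ∀ j, p j → Q j * R j = -(R j * Q j)) (hcomm : ∀ j, ¬ p j → Q j * R j = R j * Q j) :
    tensorn n Q * tensorn n R = -(tensorn n R * tensorn n Q) := by
  classical
  have hfac : (fun j => Q j * R j) = fun j => (if p j then (-1 : ℂ) else 1) • (R j * Q j) := by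
    funext j
    split_ifs with h
    · simp [hanti j h]
    · simp [hcomm j h]
  have hsign : ∏ j, (if p j then (-1 : ℂ) else 1) = -1 := by
    rw [Set.ncard_eq_toFinset_card', Set.toFinset_ofPred] at hp
    rw [Finset.prod_ite, Finset.prod_const, Finset.prod_const_one, mul_one, hp.neg_one_pow]
  rw [tensorn_mul, tensorn_mul, hfac, tensorn_smul, hsign, neg_one_smul]

theorem IsSingleQubitPauli.conjTranspose_eq {Q : Matrix (Fin 2) (Fin 2) ℂ}
    (hQ : IsSingleQubitPauli Q) : Qᴴ = Q := by
  rcases hQ with rfl | rfl | rfl | rfl <;> ext i j <;> fin_cases i <;> fin_cases j <;>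
    simp [PauliX, PauliY, PauliZ]

theorem IsSingleQubitPauli.mul_self {Q : Matrix (Fin 2) (Fin 2) ℂ}
    (hQ : IsSingleQubitPauli Q) : Q * Q = 1 := by
  rcases hQ with rfl | rfl | rfl | rfl <;> ext i j <;> fin_cases i <;> fin_cases j <;>
    simp [PauliX, PauliY, PauliZ]

theorem inv_sqrt_two_mul_self : ((√2 : ℝ) : ℂ)⁻¹ * ((√2 : ℝ) : ℂ)⁻¹ = 2⁻¹ := by
  rw [← mul_inv, ← Complex.ofReal_mul, Real.mul_self_sqrt zero_le_two, Complex.ofReal_ofNat]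

theorem Had2_conjTranspose : Had2ᴴ = Had2 := by
  ext i j
  fin_cases i <;> fin_cases j <;> simp [Had2]

theorem Had2_mul_self : Had2 * Had2 = 1 := by
  rw [Had2, smul_mul_smul_comm, inv_sqrt_two_mul_self]
  ext i j
  fin_cases i <;> fin_cases j <;> norm_num

theorem PauliY_mul_Had2 : PauliY * Had2 = -(Had2 * PauliY) := by
  ext i j
  fin_cases i <;> fin_cases j <;> simp [Had2, PauliY, mul_comm]

theorem Had2_conj_PauliX : Had2 * PauliX * Had2 = PauliZ := by
  rw [Had2, smul_mul_assoc, smul_mul_smul_comm, inv_sqrt_two_mul_self]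
  ext i j
  fin_cases i <;> fin_cases j <;> norm_num [PauliX, PauliZ]

theorem Had2_conj_PauliZ : Had2 * PauliZ * Had2 = PauliX := by
  rw [Had2, smul_mul_assoc, smul_mul_smul_comm, inv_sqrt_two_mul_self]
  ext i j
  fin_cases i <;> fin_cases j <;> norm_num [PauliX, PauliZ]

theorem Had2_conj_PauliY : Had2 * PauliY * Had2 = -PauliY := by
  rw [mul_assoc, PauliY_mul_Had2, mul_neg, ← mul_assoc, Had2_mul_self, one_mul]

theorem PauliX_mul_PauliZ : PauliX * PauliZ = -(PauliZ * PauliX) := by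
  ext i j
  fin_cases i <;> fin_cases j <;> simp [PauliX, PauliZ]

theorem HadOn_conjTranspose {n : ℕ} (A : Finset (Fin n)) : (HadOn A)ᴴ = HadOn A := by
  rw [HadOn, tensorn_conjTranspose]
  congr 1
  funext j
  split_ifs
  · exact Had2_conjTranspose
  · exact conjTranspose_one

theorem HadOn_mul_self {n : ℕ} (A : Finset (Fin n)) : HadOn A * HadOn A = 1 := by
  rw [HadOn, tensorn_mul, ← tensorn_one]
  congr 1
  funext j
  split_ifs
  · exact Had2_mul_self
  · exact one_mul 1

section Abstract

variable {ι : Type*} [Fintype ι]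

theorem star_mulVec_dotProduct_of_isHermitian {M : Matrix ι ι ℂ} (hM : Mᴴ = M) (v w : ι → ℂ) :
    star (M *ᵥ v) ⬝ᵥ w = star v ⬝ᵥ (M *ᵥ w) := by
  rw [star_mulVec, hM, dotProduct_mulVec]

/-- A vector fixed by a Hermitian matrix has zero expectation in any matrix that anticommutes
with it. -/
theorem dotProduct_mulVec_eq_zero_of_anticomm {P M : Matrix ι ι ℂ} (hP : Pᴴ = P)
    (hPM : P * M = -(M * P)) {ψ : ι → ℂ} (hψ : P *ᵥ ψ = ψ) : star ψ ⬝ᵥ (M *ᵥ ψ) = 0 := by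
  have h : star ψ ⬝ᵥ (M *ᵥ ψ) = -(star ψ ⬝ᵥ (M *ᵥ ψ)) := by
    conv_lhs => rw [← hψ, star_mulVec_dotProduct_of_isHermitian hP, hψ, mulVec_mulVec, hPM,
      neg_mulVec, ← mulVec_mulVec, hψ, dotProduct_neg]
  exact self_eq_neg.mp h

open scoped ComplexOrder in
/-- If `ψ` is fixed by a Hermitian involution `P` which anticommutes with its conjugate `H P H` by
another Hermitian involution `H`, then `⟨ψ, H ψ⟩² ≤ 1/2`. -/
theorem sq_re_dotProduct_mulVec_le_half [DecidableEq ι] {P H : Matrix ι ι ℂ}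
    (hP : Pᴴ = P) (hP2 : P * P = 1) (hH : Hᴴ = H) (hH2 : H * H = 1)
    (hanti : P * (H * P * H) = -(H * P * H * P)) {ψ : ι → ℂ} (hunit : star ψ ⬝ᵥ ψ = 1)
    (hψ : P *ᵥ ψ = ψ) : (star ψ ⬝ᵥ (H *ᵥ ψ)).re ^ 2 ≤ 1 / 2 := by
  set K := H * P * H with hKdef
  have hK : Kᴴ = K := by simp [hKdef, conjTranspose_mul, hH, hP, mul_assoc]
  have hK2 : K * K = 1 := by
    calc K * K = H * P * (H * H) * P * H := by simp only [hKdef, mul_assoc]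
      _ = H * (P * P) * H := by rw [hH2]; simp only [mul_assoc, one_mul]
      _ = 1 := by rw [hP2, mul_one, hH2]
  have hKH : K *ᵥ (H *ᵥ ψ) = H *ᵥ ψ := by
    rw [mulVec_mulVec, hKdef, mul_assoc, hH2, mul_one, ← mulVec_mulVec, hψ]
  have hψK := dotProduct_mulVec_eq_zero_of_anticomm hP hanti hψ
  set a := star ψ ⬝ᵥ (H *ᵥ ψ) with ha
  have hHψ : star (H *ᵥ ψ) ⬝ᵥ ψ = a := star_mulVec_dotProduct_of_isHermitian hH _ _
  have hHH : star (H *ᵥ ψ) ⬝ᵥ (H *ᵥ ψ) = 1 := by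
    rw [star_mulVec_dotProduct_of_isHermitian hH, mulVec_mulVec, hH2, one_mulVec, hunit]
  have hKK : star (K *ᵥ ψ) ⬝ᵥ (K *ᵥ ψ) = 1 := by
    rw [star_mulVec_dotProduct_of_isHermitian hK, mulVec_mulVec, hK2, one_mulVec, hunit]
  have hKψ : star (K *ᵥ ψ) ⬝ᵥ ψ = 0 := by
    rw [star_mulVec_dotProduct_of_isHermitian hK, hψK]
  have hKψH : star (K *ᵥ ψ) ⬝ᵥ (H *ᵥ ψ) = a := by
    rw [star_mulVec_dotProduct_of_isHermitian hK, hKH]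
  have hHKψ : star (H *ᵥ ψ) ⬝ᵥ (K *ᵥ ψ) = a := by
    rw [← star_mulVec_dotProduct_of_isHermitian hK, hKH, hHψ]
  have hnonneg := dotProduct_star_self_nonneg (H *ᵥ ψ - (a.re : ℂ) • (ψ + K *ᵥ ψ))
  simp only [star_sub, star_smul, star_add, sub_dotProduct, dotProduct_sub,
    smul_dotProduct, dotProduct_smul, add_dotProduct, dotProduct_add, hunit, hψK, hHψ, hHH, hKK,
    hKψ, hKψH, hHKψ, ← ha] at hnonneg
  have hre := (Complex.le_def.mp hnonneg).1
  simp at hre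
  nlinarith

end Abstract

/-- If a multiple of an involution fixes a unit vector, its coefficient squares to one. -/
theorem sq_eq_one_of_smul_mulVec_eq {ι : Type*} [Fintype ι] [DecidableEq ι] {T : Matrix ι ι ℂ}
    (hT2 : T * T = 1) {c : ℂ} {ψ : ι → ℂ} (hunit : star ψ ⬝ᵥ ψ = 1)
    (hψ : (c • T) *ᵥ ψ = ψ) : c ^ 2 = 1 := by
  have h : (c ^ 2) • ψ = ψ := by
    conv_rhs => rw [← hψ, ← hψ, mulVec_mulVec, smul_mul_smul_comm, hT2, smul_mulVec, one_mulVec,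
      ← sq]
  simpa [hunit] using congrArg (star ψ ⬝ᵥ ·) h

/-- A multiple of a Pauli string that fixes a unit vector is a Hermitian involution. -/
theorem isHermitian_involution_of_stabilizes {n : ℕ} {Q : Fin n → Matrix (Fin 2) (Fin 2) ℂ}
    (hQ : ∀ j, IsSingleQubitPauli (Q j)) {c : ℂ} {ψ : QVec n} (hunit : star ψ ⬝ᵥ ψ = 1)
    (hψ : (c • tensorn n Q) *ᵥ ψ = ψ) :
    (c • tensorn n Q)ᴴ = c • tensorn n Q ∧ (c • tensorn n Q) * (c • tensorn n Q) = 1 := by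
  have hT : (tensorn n Q)ᴴ = tensorn n Q := by
    simp only [tensorn_conjTranspose, (hQ _).conjTranspose_eq]
  have hT2 : tensorn n Q * tensorn n Q = 1 := by
    simp only [tensorn_mul, (hQ _).mul_self, tensorn_one]
  have hc := sq_eq_one_of_smul_mulVec_eq hT2 hunit hψ
  refine ⟨?_, by rw [smul_mul_smul_comm, hT2, ← sq, hc, one_smul]⟩
  rcases eq_or_eq_neg_of_sq_eq_sq c 1 (by rw [hc, one_pow]) with rfl | rfl <;> simp [hT]

theorem TypeIAt.dotProduct_HadOn_mulVec_eq_zero {n : ℕ} {ψ : QVec n} {A : Finset (Fin n)}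
    (h : TypeIAt ψ A) (hunit : star ψ ⬝ᵥ ψ = 1) : star ψ ⬝ᵥ (HadOn A *ᵥ ψ) = 0 := by
  obtain ⟨ℓ, Q, hQ, hψ, hA, hodd⟩ := h
  refine dotProduct_mulVec_eq_zero_of_anticomm
    (isHermitian_involution_of_stabilizes hQ hunit hψ).1 ?_ hψ
  rw [smul_mul_assoc, mul_smul_comm, ← smul_neg, HadOn]
  congr 1
  refine tensorn_anticomm _ _ _ hodd ?_ ?_
  · rintro j ⟨hj, hY⟩
    rw [if_pos hj, hY, PauliY_mul_Had2]
  · intro j hj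
    split_ifs with hjA
    · rw [(hA j hjA).resolve_right fun hY => hj ⟨hjA, hY⟩, one_mul, mul_one]
    · rw [one_mul, mul_one]

theorem TypeIIAt.sq_re_dotProduct_HadOn_mulVec_le_half {n : ℕ} {ψ : QVec n} {A : Finset (Fin n)}
    (h : TypeIIAt ψ A) (hunit : star ψ ⬝ᵥ ψ = 1) :
    (star ψ ⬝ᵥ (HadOn A *ᵥ ψ)).re ^ 2 ≤ 1 / 2 := by
  obtain ⟨ℓ, Q, hQ, hψ, hodd⟩ := h
  obtain ⟨hP, hP2⟩ := isHermitian_involution_of_stabilizes hQ hunit hψ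
  refine sq_re_dotProduct_mulVec_le_half hP hP2 (HadOn_conjTranspose A) (HadOn_mul_self A) ?_
    hunit hψ
  simp only [smul_mul_assoc, mul_smul_comm, ← smul_neg]
  congr 2
  rw [HadOn, tensorn_mul, tensorn_mul]
  refine tensorn_anticomm _ _ _ hodd ?_ ?_
  · rintro j ⟨hj, hX | hZ⟩
    · rw [if_pos hj, hX, Had2_conj_PauliX, PauliX_mul_PauliZ]
    · rw [if_pos hj, hZ, Had2_conj_PauliZ, PauliX_mul_PauliZ, neg_neg]
  · intro j hj
    split_ifs with hjA
    · rcases hQ j with h | h | h | h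
      · rw [h, mul_one, Had2_mul_self]
      · exact absurd ⟨hjA, Or.inl h⟩ hj
      · rw [h, Had2_conj_PauliY, mul_neg, neg_mul]
      · exact absurd ⟨hjA, Or.inr h⟩ hj
    · rw [one_mul, mul_one]

/-- if `stab(ψ)` is Type I or Type II at `A`, then
`⟨ψ, ((I - H_A)/2) ψ⟩ ≥ sin²(π/8)`. -/
theorem type_I_or_II_energy_bound (n : ℕ) (ψ : QVec n) (hunit : star ψ ⬝ᵥ ψ = 1)
    (A : Finset (Fin n)) (h : TypeIAt ψ A ∨ TypeIIAt ψ A) :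
    Real.sin (Real.pi / 8) ^ 2 ≤
      (star ψ ⬝ᵥ (((2 : ℂ)⁻¹ • (1 - HadOn A)) *ᵥ ψ)).re := by
  have hbound : (star ψ ⬝ᵥ (HadOn A *ᵥ ψ)).re ≤ √2 / 2 := by
    rcases h with h | h
    · rw [h.dotProduct_HadOn_mulVec_eq_zero hunit, Complex.zero_re]
      positivity
    · refine abs_le_of_sq_le_sq' ?_ (by positivity) |>.2
      rw [div_pow, Real.sq_sqrt zero_le_two]
      linarith [h.sq_re_dotProduct_HadOn_mulVec_le_half hunit]
  have hsin : Real.sin (Real.pi / 8) ^ 2 = 1 / 2 - √2 / 2 / 2 := by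
    rw [Real.sin_sq_eq_half_sub, ← Real.cos_pi_div_four]
    ring_nf
  have henergy : (star ψ ⬝ᵥ (((2 : ℂ)⁻¹ • (1 - HadOn A)) *ᵥ ψ)).re =
      2⁻¹ * (1 - (star ψ ⬝ᵥ (HadOn A *ᵥ ψ)).re) := by
    rw [smul_mulVec, sub_mulVec, one_mulVec, dotProduct_smul, dotProduct_sub, hunit]
    simp
  rw [hsin, henergy]
  linarith
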